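/- Let F be a degree-3 foliation of ℙ²(ℂ) that is not linearly conjugate to the foliation F₁ given in the chart z = 1 by ω̄₁ = y³dx + x³(x dy − y dx). Suppose F possesses a nondegenerate singular point m with BB(F,m) = 4 and κ(F,m) = 3, i.e. there exists a line ℓ through m, not invariant by F, with Tang(F,ℓ,m) = 3. Then F degenerates onto F₁: O(F₁) is contained in the closure of O(F) in F(3). -/

import Mathlib

open MvPolynomial

noncomputable section

/-- Substitution of the linear change of variables on `ℂ³` given by the matrix `M`. -/
def subst3 (M : Matrix (Fin 3) (Fin 3) ℂ) (P : MvPolynomial (Fin 3) ℂ) :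
    MvPolynomial (Fin 3) ℂ :=
  aeval (fun i => ∑ j, C (M i j) * X j) P

/-- Pullback of the 1-form with coefficient vector `Ω` by the linear map of matrix `M`. -/
def pb3 (M : Matrix (Fin 3) (Fin 3) ℂ) (Ω : Fin 3 → MvPolynomial (Fin 3) ℂ) :
    Fin 3 → MvPolynomial (Fin 3) ℂ :=
  fun i => ∑ j, C (M j i) * subst3 M (Ω j)

/-- Two foliations (given by their projective 1-forms) are linearly conjugate:
`T*Ω = c·Ω'` for some `T ∈ GL₃(ℂ)` and `c ∈ ℂ*`. -/
def LinConj3 (Ω Ω' : Fin 3 → MvPolynomial (Fin 3) ℂ) : Prop :=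
  ∃ (M : Matrix (Fin 3) (Fin 3) ℂ) (c : ℂ), IsUnit M.det ∧ c ≠ 0 ∧
    pb3 M Ω = fun i => C c * Ω' i

/-- The orbit of the 1-form `Ω` under pullback by `GL₃(ℂ)` and nonzero rescaling
(the cone over the `PGL₃(ℂ)`-orbit of the corresponding foliation). -/
def OrbitOf (Ω : Fin 3 → MvPolynomial (Fin 3) ℂ) :
    Set (Fin 3 → MvPolynomial (Fin 3) ℂ) :=
  {Ω' | LinConj3 Ω Ω'}

/-- `Ω` defines a degree-`d` foliation of `ℙ²(ℂ)`: it is a nonzero 1-form with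
homogeneous coefficients of degree `d + 1` annihilating the radial vector field and
with no common factor. -/
def IsFolDeg (d : ℕ) (Ω : Fin 3 → MvPolynomial (Fin 3) ℂ) : Prop :=
  Ω ≠ 0 ∧ (∀ i, (Ω i).IsHomogeneous (d + 1)) ∧
    X 0 * Ω 0 + X 1 * Ω 1 + X 2 * Ω 2 = 0 ∧
    ∀ h : MvPolynomial (Fin 3) ℂ, (∀ i, h ∣ Ω i) → IsUnit h

/-- The coefficient vector of a triple of polynomials. -/
def coeffs (Ω : Fin 3 → MvPolynomial (Fin 3) ℂ) : Fin 3 → (Fin 3 →₀ ℕ) → ℂ :=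
  fun i m => coeff m (Ω i)

/-- Closure, inside the space `F(d)` of degree-`d` foliations with its classical
topology (read off on the coefficients), of a set of defining 1-forms. -/
def FClos (d : ℕ) (S : Set (Fin 3 → MvPolynomial (Fin 3) ℂ)) :
    Set (Fin 3 → MvPolynomial (Fin 3) ℂ) :=
  {Ω' | IsFolDeg d Ω' ∧ coeffs Ω' ∈ closure (coeffs '' S)}

/-- `√3` as a complex number. -/
def s3 : ℂ := (Real.sqrt 3 : ℝ)

/-- Projective 1-form of `H₁ : y³dx − x³dy`. -/
def OmH1 : Fin 3 → MvPolynomial (Fin 3) ℂ :=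
  ![X 2 * X 1 ^ 3, -(X 2 * X 0 ^ 3), X 0 ^ 3 * X 1 - X 0 * X 1 ^ 3]

/-- Projective 1-form of `H₂ : x³dx − y³dy`. -/
def OmH2 : Fin 3 → MvPolynomial (Fin 3) ℂ :=
  ![X 2 * X 0 ^ 3, -(X 2 * X 1 ^ 3), X 1 ^ 4 - X 0 ^ 4]

/-- Projective 1-form of `H₃ : y²(3x+y)dx − x²(x+3y)dy`. -/
def OmH3 : Fin 3 → MvPolynomial (Fin 3) ℂ :=
  ![X 2 * (3 * X 0 * X 1 ^ 2 + X 1 ^ 3), -(X 2 * (X 0 ^ 3 + 3 * X 0 ^ 2 * X 1)),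
    X 0 ^ 3 * X 1 - X 0 * X 1 ^ 3]

/-- Projective 1-form of `H₄ : y²(3x+y)dx + x²(x+3y)dy`. -/
def OmH4 : Fin 3 → MvPolynomial (Fin 3) ℂ :=
  ![X 2 * (3 * X 0 * X 1 ^ 2 + X 1 ^ 3), X 2 * (X 0 ^ 3 + 3 * X 0 ^ 2 * X 1),
    -(X 0 ^ 3 * X 1 + 6 * X 0 ^ 2 * X 1 ^ 2 + X 0 * X 1 ^ 3)]

/-- Projective 1-form of `H₅ : 2y³dx + x²(3y−2x)dy`. -/
def OmH5 : Fin 3 → MvPolynomial (Fin 3) ℂ :=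
  ![2 * X 2 * X 1 ^ 3, X 2 * (3 * X 0 ^ 2 * X 1 - 2 * X 0 ^ 3),
    -(2 * X 0 * X 1 ^ 3 + 3 * X 0 ^ 2 * X 1 ^ 2 - 2 * X 0 ^ 3 * X 1)]

/-- Projective 1-form of `H₆ : (4x³−6x²y+4y³)dx + x²(3y−2x)dy`. -/
def OmH6 : Fin 3 → MvPolynomial (Fin 3) ℂ :=
  ![X 2 * (4 * X 0 ^ 3 - 6 * X 0 ^ 2 * X 1 + 4 * X 1 ^ 3),
    X 2 * (3 * X 0 ^ 2 * X 1 - 2 * X 0 ^ 3),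
    -(4 * X 0 ^ 4 - 8 * X 0 ^ 3 * X 1 + 3 * X 0 ^ 2 * X 1 ^ 2 + 4 * X 0 * X 1 ^ 3)]

/-- Projective 1-form of `H₇ : y³dx + x(3y²−x²)dy`. -/
def OmH7 : Fin 3 → MvPolynomial (Fin 3) ℂ :=
  ![X 2 * X 1 ^ 3, X 2 * (3 * X 0 * X 1 ^ 2 - X 0 ^ 3),
    X 0 ^ 3 * X 1 - 4 * X 0 * X 1 ^ 3]

/-- Projective 1-form of `H₈ : x(x²−3y²)dx − 4y³dy`. -/
def OmH8 : Fin 3 → MvPolynomial (Fin 3) ℂ :=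
  ![X 2 * (X 0 ^ 3 - 3 * X 0 * X 1 ^ 2), -(4 * X 2 * X 1 ^ 3),
    -(X 0 ^ 4 - 3 * X 0 ^ 2 * X 1 ^ 2 - 4 * X 1 ^ 4)]

/-- Projective 1-form of `H₉ : y²((−3+i√3)x+2y)dx + x²((1+i√3)x−2i√3·y)dy`. -/
def OmH9 : Fin 3 → MvPolynomial (Fin 3) ℂ :=
  ![X 2 * (C (-3 + Complex.I * s3) * X 0 * X 1 ^ 2 + 2 * X 1 ^ 3),
    X 2 * (C (1 + Complex.I * s3) * X 0 ^ 3 - C (2 * (Complex.I * s3)) * X 0 ^ 2 * X 1),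
    -(C (1 + Complex.I * s3) * X 0 ^ 3 * X 1 + C (-3 - Complex.I * s3) * X 0 ^ 2 * X 1 ^ 2 +
      2 * X 0 * X 1 ^ 3)]

/-- Projective 1-form of
`H₁₁ : (3x³+3√3x²y+3xy²+√3y³)dx + (√3x³+3x²y+3√3xy²+3y³)dy`. -/
def OmH11 : Fin 3 → MvPolynomial (Fin 3) ℂ :=
  ![X 2 * (3 * X 0 ^ 3 + C (3 * s3) * X 0 ^ 2 * X 1 + 3 * X 0 * X 1 ^ 2 + C s3 * X 1 ^ 3),
    X 2 * (C s3 * X 0 ^ 3 + 3 * X 0 ^ 2 * X 1 + C (3 * s3) * X 0 * X 1 ^ 2 + 3 * X 1 ^ 3),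
    -(3 * X 0 ^ 4 + C (4 * s3) * X 0 ^ 3 * X 1 + 6 * X 0 ^ 2 * X 1 ^ 2 +
      C (4 * s3) * X 0 * X 1 ^ 3 + 3 * X 1 ^ 4)]

/-- Projective 1-form of `F₁ : y³dx + x³(x dy − y dx)`. -/
def OmF1 : Fin 3 → MvPolynomial (Fin 3) ℂ :=
  ![X 2 * X 1 ^ 3 - X 0 ^ 3 * X 1, X 0 ^ 4, -(X 0 * X 1 ^ 3)]

/-- Projective 1-form of `F₂ : x³dx + y³(x dy − y dx)`. -/
def OmF2 : Fin 3 → MvPolynomial (Fin 3) ℂ :=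
  ![X 2 * X 0 ^ 3 - X 1 ^ 4, X 0 * X 1 ^ 3, -(X 0 ^ 4)]

/-- Projective 1-form of the Fermat foliation `F₃ : (x³−x)dy − (y³−y)dx`. -/
def OmF3 : Fin 3 → MvPolynomial (Fin 3) ℂ :=
  ![X 1 * X 2 ^ 3 - X 1 ^ 3 * X 2, X 0 ^ 3 * X 2 - X 0 * X 2 ^ 3,
    X 0 * X 1 ^ 3 - X 0 ^ 3 * X 1]

/-- Projective 1-form of `F₄ : (x³+y³)dx + x³(x dy − y dx)`. -/
def OmF4 : Fin 3 → MvPolynomial (Fin 3) ℂ :=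
  ![X 2 * (X 0 ^ 3 + X 1 ^ 3) - X 0 ^ 3 * X 1, X 0 ^ 4, -(X 0 ^ 4 + X 0 * X 1 ^ 3)]

/-- Projective 1-form of `F₅ : y²(y dx + 2x dy) + x³(x dy − y dx)`. -/
def OmF5 : Fin 3 → MvPolynomial (Fin 3) ℂ :=
  ![X 2 * X 1 ^ 3 - X 0 ^ 3 * X 1, 2 * X 0 * X 1 ^ 2 * X 2 + X 0 ^ 4,
    -(3 * X 0 * X 1 ^ 3)]

/-- The line `ker L` is invariant by the foliation defined by the 1-form `Ω`:
`L` divides the coefficients of `Ω ∧ dL`. -/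
def LineInv (Ω : Fin 3 → MvPolynomial (Fin 3) ℂ) (L : MvPolynomial (Fin 3) ℂ) : Prop :=
  L ∣ (Ω 0 * pderiv 1 L - Ω 1 * pderiv 0 L) ∧
  L ∣ (Ω 0 * pderiv 2 L - Ω 2 * pderiv 0 L) ∧
  L ∣ (Ω 1 * pderiv 2 L - Ω 2 * pderiv 1 L)

/-- The restriction of a polynomial to the affine line `t ↦ m + t·w` in the
standard chart `x_k = 1`. -/
def lineRestrict (k : Fin 3) (m w : Fin 3 → ℂ) (P : MvPolynomial (Fin 3) ℂ) :
    Polynomial ℂ :=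
  aeval (fun l => if l = k then 1 else Polynomial.C (m l) + Polynomial.C (w l) *
    Polynomial.X) P

/-- The tangency polynomial of the foliation `Ω` with the affine line `t ↦ m + t·w`
(in the chart `x_k = 1`): `t ↦ ω_{m+tw}(w)`.  Its order of vanishing at `t = 0` is the
tangency order `Tang(F, ℓ, m)` of the foliation with the line at `m`. -/
def tangPoly (Ω : Fin 3 → MvPolynomial (Fin 3) ℂ) (k : Fin 3) (m w : Fin 3 → ℂ) :
    Polynomial ℂ :=
  ∑ l, Polynomial.C (w l) * lineRestrict k m w (Ω l)

def mk3 (p r q : ℕ) : Fin 3 →₀ ℕ := Finsupp.equivFunOnFinite.symm ![p, r, q]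

lemma mk3_0 (p r q : ℕ) : mk3 p r q 0 = p := rfl
lemma mk3_1 (p r q : ℕ) : mk3 p r q 1 = r := rfl
lemma mk3_2 (p r q : ℕ) : mk3 p r q 2 = q := rfl

lemma eq_mk3 (m : Fin 3 →₀ ℕ) : m = mk3 (m 0) (m 1) (m 2) := by
  ext i; fin_cases i <;> rfl

lemma mk3_inj (p r q p' r' q' : ℕ) : mk3 p r q = mk3 p' r' q' ↔ p = p' ∧ r = r' ∧ q = q' := by
  constructor
  · intro h
    exact ⟨DFunLike.congr_fun h 0, DFunLike.congr_fun h 1, DFunLike.congr_fun h 2⟩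
  · rintro ⟨rfl, rfl, rfl⟩; rfl

lemma mk3_mono (p r q : ℕ) : (monomial (mk3 p r q) (1:ℂ)) = X 0 ^ p * X 1 ^ r * X 2 ^ q := by
  rw [MvPolynomial.monomial_eq, Finsupp.prod_fintype _ _ (by simp)]
  simp [Fin.prod_univ_three, mk3_0, mk3_1, mk3_2]

lemma hom_deg {P : MvPolynomial (Fin 3) ℂ} {d : ℕ} (hP : P.IsHomogeneous d)
    {m : Fin 3 →₀ ℕ} (h : coeff m P ≠ 0) : m 0 + m 1 + m 2 = d := by
  have := hP h
  rw [← this, Finsupp.weight_apply, Finsupp.sum_fintype _ _ (by simp)]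
  simp [Fin.sum_univ_three]

lemma hom_of {P : MvPolynomial (Fin 3) ℂ} {d : ℕ}
    (hP : ∀ m : Fin 3 →₀ ℕ, coeff m P ≠ 0 → m 0 + m 1 + m 2 = d) : P.IsHomogeneous d := by
  intro m h
  rw [← hP m h, Finsupp.weight_apply, Finsupp.sum_fintype _ _ (by simp)]
  simp [Fin.sum_univ_three]

lemma hom_pderiv {P : MvPolynomial (Fin 3) ℂ} {d : ℕ} (hP : P.IsHomogeneous (d+1)) (i : Fin 3) :
    (pderiv i P).IsHomogeneous d := by
  apply hom_of
  intro m h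
  rw [coeff_pderiv] at h
  have := hom_deg hP (left_ne_zero_of_mul h)
  fin_cases i <;> simp at this <;> omega

lemma restr_coeff {P : MvPolynomial (Fin 3) ℂ} {d : ℕ} (hP : P.IsHomogeneous d) (n : ℕ)
    (hn : n ≤ d) :
    (aeval (![Polynomial.X, 1, 0] : Fin 3 → Polynomial ℂ) P).coeff n
      = coeff (mk3 n (d - n) 0) P := by
  rw [aeval_def, eval₂_eq', Polynomial.finsetSum_coeff]
  rw [Finset.sum_eq_single (mk3 n (d - n) 0)]
  · simp [Fin.prod_univ_three, mk3_0, mk3_1, mk3_2]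
  · intro m hm hne
    have hd := hom_deg hP (mem_support_iff.mp hm)
    simp only [Fin.prod_univ_three, Matrix.cons_val_zero, Matrix.cons_val_one, Matrix.cons_val,
      one_pow, mul_one, Polynomial.algebraMap_eq, Polynomial.coeff_C_mul]
    by_cases h2 : m 2 = 0
    · rw [h2, pow_zero, mul_one, Polynomial.coeff_X_pow, if_neg, mul_zero]
      intro h0
      apply hne
      rw [eq_mk3 m, mk3_inj]
      omega
    · simp [zero_pow h2]
  · intro h
    simp [notMem_support_iff.mp h]

lemma eval_e1 {P : MvPolynomial (Fin 3) ℂ} {d : ℕ} (hP : P.IsHomogeneous d) :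
    eval (![0, 1, 0] : Fin 3 → ℂ) P = coeff (mk3 0 d 0) P := by
  have h := restr_coeff hP 0 (Nat.zero_le d)
  rw [Nat.sub_zero] at h
  rw [← h, Polynomial.coeff_zero_eq_eval_zero, ← Polynomial.coe_evalRingHom,
    ← Polynomial.coe_aeval_eq_evalRingHom]
  change _ = ((Polynomial.aeval (0:ℂ)).comp (aeval (![Polynomial.X, 1, 0] : Fin 3 → Polynomial ℂ))) P
  rw [← MvPolynomial.coe_aeval_eq_eval]
  change (aeval (![0, 1, 0] : Fin 3 → ℂ) : MvPolynomial (Fin 3) ℂ →ₐ[ℂ] ℂ) P = _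
  congr 1
  ext i; fin_cases i <;> simp

lemma eval_e1_pderiv {P : MvPolynomial (Fin 3) ℂ} {d : ℕ} (hP : P.IsHomogeneous (d+1)) :
    eval (![0, 1, 0] : Fin 3 → ℂ) (pderiv 2 P) = coeff (mk3 0 d 1) P ∧
    eval (![0, 1, 0] : Fin 3 → ℂ) (pderiv 0 P) = coeff (mk3 1 d 0) P := by
  rw [eval_e1 (hom_pderiv hP 2), eval_e1 (hom_pderiv hP 0), coeff_pderiv, coeff_pderiv]
  have h1 : mk3 0 d 0 + Finsupp.single 2 1 = mk3 0 d 1 := by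
    ext i; fin_cases i <;> simp [mk3]
  have h2 : mk3 0 d 0 + Finsupp.single 0 1 = mk3 1 d 0 := by
    ext i; fin_cases i <;> simp [mk3]
  rw [h1, h2]
  simp [mk3]

/-! ### substitution -/

lemma subst3_hom (M : Matrix (Fin 3) (Fin 3) ℂ) {P : MvPolynomial (Fin 3) ℂ} {d : ℕ}
    (hP : P.IsHomogeneous d) : (subst3 M P).IsHomogeneous d := by
  have := hP.aeval (n := 1) (fun i => ∑ j, C (M i j) * X j)
    (fun i => IsHomogeneous.sum _ _ _ fun j _ => by
      simpa using (isHomogeneous_C _ (M i j)).mul (isHomogeneous_X ℂ j))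
  simpa [subst3] using this

lemma pb3_hom (M : Matrix (Fin 3) (Fin 3) ℂ) {Ω : Fin 3 → MvPolynomial (Fin 3) ℂ} {d : ℕ}
    (hP : ∀ i, (Ω i).IsHomogeneous d) (i : Fin 3) : (pb3 M Ω i).IsHomogeneous d := by
  refine IsHomogeneous.sum _ _ _ fun j _ => ?_
  simpa using (isHomogeneous_C _ (M j i)).mul (subst3_hom M (hP j))

lemma subst3_add (M : Matrix (Fin 3) (Fin 3) ℂ) (P Q) :
    subst3 M (P + Q) = subst3 M P + subst3 M Q := by simp [subst3]
lemma subst3_mul (M : Matrix (Fin 3) (Fin 3) ℂ) (P Q) :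
    subst3 M (P * Q) = subst3 M P * subst3 M Q := by simp [subst3]
lemma subst3_C (M : Matrix (Fin 3) (Fin 3) ℂ) (c : ℂ) : subst3 M (C c) = C c := by
  simp [subst3, algebraMap_eq]
lemma subst3_X (M : Matrix (Fin 3) (Fin 3) ℂ) (i) :
    subst3 M (X i) = ∑ j, C (M i j) * X j := by simp [subst3]
lemma subst3_sum (M : Matrix (Fin 3) (Fin 3) ℂ) {ι : Type*} (s : Finset ι)
    (f : ι → MvPolynomial (Fin 3) ℂ) :
    subst3 M (∑ i ∈ s, f i) = ∑ i ∈ s, subst3 M (f i) := by simp [subst3]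

lemma subst3_comp (M N : Matrix (Fin 3) (Fin 3) ℂ) (P : MvPolynomial (Fin 3) ℂ) :
    subst3 N (subst3 M P) = subst3 (M * N) P := by
  induction P using MvPolynomial.induction_on with
  | C a => simp only [subst3_C]
  | add P Q h1 h2 => simp only [subst3_add, h1, h2]
  | mul_X P i h =>
    rw [subst3_mul, subst3_mul, subst3_mul, h]
    refine congrArg _ ?_
    simp only [subst3_X, subst3_add, subst3_mul, subst3_C, Matrix.mul_apply, Fin.sum_univ_three,
      C_add, C_mul]
    ring

lemma subst3_one (P : MvPolynomial (Fin 3) ℂ) : subst3 1 P = P := by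
  have : (fun i : Fin 3 => ∑ j, C ((1 : Matrix (Fin 3) (Fin 3) ℂ) i j) * X j)
      = (X : Fin 3 → MvPolynomial (Fin 3) ℂ) := by
    funext i; fin_cases i <;> simp [Fin.sum_univ_three, Matrix.one_apply]
  rw [subst3, this]; simp

lemma pb3_comp (M N : Matrix (Fin 3) (Fin 3) ℂ) (Ω : Fin 3 → MvPolynomial (Fin 3) ℂ) :
    pb3 N (pb3 M Ω) = pb3 (M * N) Ω := by
  funext i
  simp only [pb3, subst3_add, subst3_mul, subst3_C, subst3_comp, Matrix.mul_apply,
    Fin.sum_univ_three, C_add, C_mul]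
  ring

lemma pb3_smul (M : Matrix (Fin 3) (Fin 3) ℂ) (c : ℂ) (Ω : Fin 3 → MvPolynomial (Fin 3) ℂ) :
    pb3 M (fun i => C c * Ω i) = fun i => C c * pb3 M Ω i := by
  funext i
  simp only [pb3, subst3_mul, subst3_C, Fin.sum_univ_three]
  ring

lemma eval_subst3 (M : Matrix (Fin 3) (Fin 3) ℂ) (P : MvPolynomial (Fin 3) ℂ) (p : Fin 3 → ℂ) :
    eval p (subst3 M P) = eval (M.mulVec p) P := by
  induction P using MvPolynomial.induction_on with
  | C a => simp [subst3_C]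
  | add P Q h1 h2 => simp [subst3_add, h1, h2]
  | mul_X P i h => simp [subst3_mul, h, subst3_X, Matrix.mulVec, dotProduct]

lemma eval_pderiv_subst3 (M : Matrix (Fin 3) (Fin 3) ℂ) (P : MvPolynomial (Fin 3) ℂ)
    (p : Fin 3 → ℂ) (b : Fin 3) :
    eval p (pderiv b (subst3 M P)) = ∑ l, M l b * eval (M.mulVec p) (pderiv l P) := by
  induction P using MvPolynomial.induction_on with
  | C a => simp [subst3_C]
  | add P Q h1 h2 => simp [subst3_add, h1, h2, mul_add, Finset.sum_add_distrib]
  | mul_X P i h =>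
    rw [subst3_mul, pderiv_mul, map_add, map_mul, map_mul, h, eval_subst3, eval_subst3]
    have : eval p (pderiv b (subst3 M (X i))) = M i b := by
      rw [subst3_X]
      simp [pderiv_X, Pi.single_apply]
    rw [this]
    simp only [pderiv_mul, map_add, map_mul, eval_X, pderiv_X, Pi.single_apply, apply_ite (eval _),
      map_one, map_zero]
    fin_cases i <;> simp [Fin.sum_univ_three] <;> ring

lemma tang_restr (Ω : Fin 3 → MvPolynomial (Fin 3) ℂ) (k : Fin 3) (m w : Fin 3 → ℂ)
    (M : Matrix (Fin 3) (Fin 3) ℂ) (hw : ∀ i, M i 0 = w i) (hm : ∀ i, M i 1 = m i)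
    (hk : m k = 1) (hwk : w k = 0) :
    aeval (![Polynomial.X, 1, 0] : Fin 3 → Polynomial ℂ) (pb3 M Ω 0) = tangPoly Ω k m w := by
  have key : ∀ P, aeval (![Polynomial.X, 1, 0] : Fin 3 → Polynomial ℂ) (subst3 M P)
      = lineRestrict k m w P := by
    intro P
    induction P using MvPolynomial.induction_on with
    | C a => simp [subst3_C, lineRestrict]
    | add P Q h1 h2 => rw [subst3_add, map_add, h1, h2]; simp [lineRestrict]
    | mul_X P i h =>
      rw [subst3_mul, map_mul, h, lineRestrict, lineRestrict, map_mul]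
      refine congrArg _ ?_
      rw [subst3_X, aeval_X]
      by_cases h : i = k
      · subst h
        simp [Fin.sum_univ_three, hw, hm, hk, hwk]
      · simp [Fin.sum_univ_three, hw, hm, h, Polynomial.algebraMap_eq, add_comm]
  simp [pb3, tangPoly, key, hw, Polynomial.algebraMap_eq]

/-! ### foliations in an orbit -/

lemma euler_pb3 (M : Matrix (Fin 3) (Fin 3) ℂ) (Ω : Fin 3 → MvPolynomial (Fin 3) ℂ)
    (h : X 0 * Ω 0 + X 1 * Ω 1 + X 2 * Ω 2 = 0) :
    X 0 * pb3 M Ω 0 + X 1 * pb3 M Ω 1 + X 2 * pb3 M Ω 2 = 0 := by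
  have h2 : subst3 M (X 0 * Ω 0 + X 1 * Ω 1 + X 2 * Ω 2) = 0 := by
    rw [h]; simp [subst3]
  rw [← h2]
  simp only [pb3, subst3_add, subst3_mul, subst3_X, Fin.sum_univ_three]
  ring

lemma subst3_unit (M : Matrix (Fin 3) (Fin 3) ℂ) {u : MvPolynomial (Fin 3) ℂ} (hu : IsUnit u) :
    IsUnit (subst3 M u) :=
  hu.map (aeval (fun i => ∑ j, C (M i j) * X j) : MvPolynomial (Fin 3) ℂ →ₐ[ℂ] _)

lemma pb3_one (Ω : Fin 3 → MvPolynomial (Fin 3) ℂ) : pb3 1 Ω = Ω := by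
  funext i
  fin_cases i <;> simp [pb3, subst3_one, Fin.sum_univ_three, Matrix.one_apply]

lemma isFol_conj {d : ℕ} {Ω Ω' : Fin 3 → MvPolynomial (Fin 3) ℂ} (h : IsFolDeg d Ω)
    (hc : LinConj3 Ω Ω') : IsFolDeg d Ω' := by
  obtain ⟨M, c, hM, hc0, hpb⟩ := hc
  obtain ⟨-, hhom, heul, hfac⟩ := h
  have hΩ' : Ω' = fun i => C c⁻¹ * pb3 M Ω i := by
    funext i
    rw [hpb, ← mul_assoc, ← C_mul, inv_mul_cancel₀ hc0, C_1, one_mul]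
  have hfac' : ∀ h : MvPolynomial (Fin 3) ℂ, (∀ i, h ∣ Ω' i) → IsUnit h := by
    intro h hd
    have h1 : IsUnit (subst3 M⁻¹ h) := by
      apply hfac
      have h2 : pb3 M⁻¹ (pb3 M Ω) = Ω := by
        rw [pb3_comp, Matrix.mul_nonsing_inv _ hM, pb3_one]
      intro i
      rw [← h2, hpb]
      simp only [pb3]
      refine Finset.dvd_sum fun j _ => Dvd.dvd.mul_left ?_ _
      rw [subst3_mul]
      refine Dvd.dvd.mul_left ?_ _
      obtain ⟨g, hg⟩ := hd j
      rw [hg, subst3_mul]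
      exact dvd_mul_right _ _
    have h3 := subst3_unit M h1
    rwa [subst3_comp, Matrix.nonsing_inv_mul _ hM, subst3_one] at h3
  refine ⟨?_, ?_, ?_, hfac'⟩
  · intro h0
    have := hfac' 0 (fun i => by rw [h0]; exact dvd_refl _)
    exact not_isUnit_zero this
  · intro i
    rw [hΩ']
    simpa using (isHomogeneous_C _ (c⁻¹)).mul (pb3_hom M hhom i)
  · have := euler_pb3 M Ω heul
    rw [hΩ']
    linear_combination C c⁻¹ * this

lemma F1_0 : OmF1 0 = monomial (mk3 0 3 1) 1 - monomial (mk3 3 1 0) 1 := by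
  rw [mk3_mono, mk3_mono]; simp [OmF1]; ring
lemma F1_1 : OmF1 1 = monomial (mk3 4 0 0) 1 := by
  rw [mk3_mono]; simp [OmF1]
lemma F1_2 : OmF1 2 = - monomial (mk3 1 3 0) 1 := by
  rw [mk3_mono]; simp [OmF1]

lemma F1_hom (i : Fin 3) : (OmF1 i).IsHomogeneous 4 := by
  have hmon : ∀ p r q, p + r + q = 4 →
      (monomial (mk3 p r q) (1:ℂ)).IsHomogeneous 4 := by
    intro p r q h
    apply hom_of
    intro m hm
    rw [coeff_monomial] at hm
    have : mk3 p r q = m := by by_contra h; simp [h] at hm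
    rw [← this, mk3_0, mk3_1, mk3_2, h]
  fin_cases i
  · change (OmF1 0).IsHomogeneous 4
    rw [F1_0]; exact (hmon _ _ _ rfl).sub (hmon _ _ _ rfl)
  · change (OmF1 1).IsHomogeneous 4
    rw [F1_1]; exact (hmon _ _ _ rfl)
  · change (OmF1 2).IsHomogeneous 4
    rw [F1_2]; exact (hmon _ _ _ rfl).neg

lemma F1_fol : IsFolDeg 3 OmF1 := by
  have hfac : ∀ h : MvPolynomial (Fin 3) ℂ, (∀ i, h ∣ OmF1 i) → IsUnit h := by
    intro h hd
    have h1 : h ∣ X 0 ^ 4 := hd 1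
    have h0 : h ∣ X 2 * X 1 ^ 3 - X 0 ^ 3 * X 1 := hd 0
    obtain ⟨n, -, hn⟩ := (dvd_prime_pow (X_prime (R := ℂ) (i := (0 : Fin 3))) 4).mp h1
    rcases Nat.eq_zero_or_pos n with rfl | hpos
    · rw [pow_zero] at hn
      exact hn.isUnit_iff.mpr isUnit_one
    · exfalso
      have h2 : (X 0 : MvPolynomial (Fin 3) ℂ) ∣ X 2 * X 1 ^ 3 - X 0 ^ 3 * X 1 :=
        ((dvd_pow_self _ hpos.ne').trans hn.symm.dvd).trans h0
      obtain ⟨g, hg⟩ := h2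
      have := congrArg (eval (![0, 1, 1] : Fin 3 → ℂ)) hg
      simp at this
  refine ⟨?_, F1_hom, ?_, hfac⟩
  · intro h0
    exact not_isUnit_zero (hfac 0 (fun i => by rw [h0]; exact dvd_refl _))
  · simp [OmF1]; ring

/-! ### limits -/
open Filter Topology

lemma coeff_diag (d : Fin 3 → ℂ) (P : MvPolynomial (Fin 3) ℂ) (m : Fin 3 →₀ ℕ) :
    coeff m (subst3 (Matrix.diagonal d) P)
      = coeff m P * (d 0 ^ m 0 * d 1 ^ m 1 * d 2 ^ m 2) := by
  induction P using MvPolynomial.induction_on' with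
  | add p q hp hq => simp only [subst3_add, coeff_add, hp, hq]; ring
  | monomial n a =>
    have hX : ∀ i, subst3 (Matrix.diagonal d) (X i) = C (d i) * X i := by
      intro i; rw [subst3_X]
      fin_cases i <;> simp [Fin.sum_univ_three]
    have : subst3 (Matrix.diagonal d) (monomial n a)
        = monomial n (a * (d 0 ^ n 0 * d 1 ^ n 1 * d 2 ^ n 2)) := by
      have e : ∀ b : ℂ, monomial n b = C b * (X 0 ^ n 0 * X 1 ^ n 1 * X 2 ^ n 2) := by
        intro b
        rw [MvPolynomial.monomial_eq, Finsupp.prod_fintype _ _ (by simp), Fin.prod_univ_three]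
      have hpow : ∀ (Q : MvPolynomial (Fin 3) ℂ) k, subst3 (Matrix.diagonal d) (Q ^ k)
          = subst3 (Matrix.diagonal d) Q ^ k := by intro Q k; simp [subst3]
      rw [e, e]
      simp only [subst3_mul, subst3_C, hpow, hX, C_mul, C_pow]
      ring
    rw [this, coeff_monomial, coeff_monomial]
    split_ifs with h
    · rw [h]
    · simp

lemma pb3_diag (d : Fin 3 → ℂ) (Ω : Fin 3 → MvPolynomial (Fin 3) ℂ) (i : Fin 3) :
    pb3 (Matrix.diagonal d) Ω i = C (d i) * subst3 (Matrix.diagonal d) (Ω i) := by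
  fin_cases i <;> simp [pb3, Fin.sum_univ_three]

lemma tend_subst3 {l : Filter ℂ} (R : Matrix (Fin 3) (Fin 3) ℂ) {d : ℕ}
    (P : ℂ → MvPolynomial (Fin 3) ℂ) (Q : MvPolynomial (Fin 3) ℂ)
    (hP : ∀ s, (P s).IsHomogeneous d) (hQ : Q.IsHomogeneous d)
    (h : ∀ m, Tendsto (fun s => coeff m (P s)) l (𝓝 (coeff m Q))) (m : Fin 3 →₀ ℕ) :
    Tendsto (fun s => coeff m (subst3 R (P s))) l (𝓝 (coeff m (subst3 R Q))) := by
  have key : ∀ P : MvPolynomial (Fin 3) ℂ, P.IsHomogeneous d →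
      coeff m (subst3 R P) = ∑ n ∈ Finset.univ.finsuppAntidiag d,
        coeff n P * coeff m (subst3 R (monomial n 1)) := by
    intro P hP
    have h1 : P = ∑ n ∈ (Finset.univ : Finset (Fin 3)).finsuppAntidiag d,
        C (coeff n P) * monomial n 1 := by
      conv_lhs => rw [P.as_sum]
      have : ∀ n, C (coeff n P) * monomial n 1 = monomial n (coeff n P) := by
        intro n; rw [C_mul_monomial, mul_one]
      simp only [this]
      apply Finset.sum_subset
      · intro n hn
        rw [Finset.mem_finsuppAntidiag]
        refine ⟨?_, Finset.subset_univ _⟩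
        rw [Fin.sum_univ_three]
        exact hom_deg hP (mem_support_iff.mp hn)
      · intro n _ hn
        rw [notMem_support_iff.mp hn, monomial_zero]
    conv_lhs => rw [h1]
    rw [subst3_sum, coeff_sum]
    refine Finset.sum_congr rfl fun n _ => ?_
    rw [subst3_mul, subst3_C, coeff_C_mul]
  rw [key Q hQ]
  have : (fun s => coeff m (subst3 R (P s))) = fun s => ∑ n ∈ Finset.univ.finsuppAntidiag d,
        coeff n (P s) * coeff m (subst3 R (monomial n 1)) := by
    funext s; exact key _ (hP s)
  rw [this]
  exact tendsto_finsetSum _ fun n _ => (h n).mul_const _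

lemma tend_pb3 {l : Filter ℂ} (R : Matrix (Fin 3) (Fin 3) ℂ) {d : ℕ}
    (P : ℂ → Fin 3 → MvPolynomial (Fin 3) ℂ) (Q : Fin 3 → MvPolynomial (Fin 3) ℂ)
    (hP : ∀ s i, (P s i).IsHomogeneous d) (hQ : ∀ i, (Q i).IsHomogeneous d)
    (h : ∀ i m, Tendsto (fun s => coeff m (P s i)) l (𝓝 (coeff m (Q i))))
    (i : Fin 3) (m : Fin 3 →₀ ℕ) :
    Tendsto (fun s => coeff m (pb3 R (P s) i)) l (𝓝 (coeff m (pb3 R Q i))) := by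
  simp only [pb3, coeff_sum, coeff_C_mul]
  exact tendsto_finsetSum _ fun j _ =>
    (tend_subst3 R (fun s => P s j) (Q j) (fun s => hP s j) (hQ j) (h j) m).const_mul _

lemma tend_weight (K B : ℂ) (w : ℕ) (h1 : w < 4 → K = 0) (h2 : w = 4 → K = B)
    (h3 : w ≠ 4 → B = 0) (f : ℂ → ℂ) (hf : ∀ s, f s = K * s ^ w * (s ^ 4)⁻¹) :
    Tendsto f (𝓝[≠] 0) (𝓝 B) := by
  have hK : w < 4 → B = 0 → Tendsto f (𝓝[≠] 0) (𝓝 B) := by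
    intro hw hB
    have : f = fun _ => 0 := by funext s; rw [hf, h1 hw]; simp
    rw [this, hB]; exact tendsto_const_nhds
  have hge : 4 ≤ w → Tendsto f (𝓝[≠] 0) (𝓝 B) := by
    intro hw
    obtain ⟨e, rfl⟩ := Nat.exists_eq_add_of_le hw
    have hev : f =ᶠ[𝓝[≠] 0] fun s => K * s ^ e := by
      filter_upwards [self_mem_nhdsWithin] with s hs
      have hs : s ≠ 0 := hs
      rw [hf, pow_add]; field_simp
    refine Tendsto.congr' hev.symm ?_
    have hc : Tendsto (fun s : ℂ => K * s ^ e) (𝓝 0) (𝓝 (K * 0 ^ e)) := by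
      have : Continuous fun s : ℂ => K * s ^ e := by fun_prop
      exact this.tendsto 0
    have hB : K * 0 ^ e = B := by
      rcases Nat.eq_zero_or_pos e with rfl | he
      · simpa using h2 rfl
      · rw [zero_pow he.ne', mul_zero, h3 (by omega)]
    rw [hB] at hc
    exact hc.mono_left nhdsWithin_le_nhds
  by_cases hw : 4 ≤ w
  · exact hge hw
  · exact hK (by omega) (h3 (by omega))

lemma euler_coeff (Ω : Fin 3 → MvPolynomial (Fin 3) ℂ)
    (h : X 0 * Ω 0 + X 1 * Ω 1 + X 2 * Ω 2 = 0) (p r q : ℕ) :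
    coeff (mk3 p r q) (Ω 1) = -(if p = 0 then 0 else coeff (mk3 (p-1) (r+1) q) (Ω 0))
      - (if q = 0 then 0 else coeff (mk3 p (r+1) (q-1)) (Ω 2)) := by
  have h1 := congrArg (coeff (mk3 p (r+1) q)) h
  simp only [coeff_add, coeff_X_mul', coeff_zero, Finsupp.mem_support_iff, mk3_0, mk3_1, mk3_2] at h1
  have e0 : mk3 p (r+1) q - Finsupp.single 0 1 = mk3 (p-1) (r+1) q := by
    ext i; fin_cases i <;> simp [mk3]
  have e1 : mk3 p (r+1) q - Finsupp.single 1 1 = mk3 p r q := by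
    ext i; fin_cases i <;> simp [mk3]
  have e2 : mk3 p (r+1) q - Finsupp.single 2 1 = mk3 p (r+1) (q-1) := by
    ext i; fin_cases i <;> simp [mk3]
  rw [e0, e1, e2] at h1
  simp only [ne_eq, ite_not, Nat.add_eq_zero_iff, one_ne_zero, and_false, if_false] at h1
  linear_combination h1

lemma main_lim (Ω : Fin 3 → MvPolynomial (Fin 3) ℂ) (a c : ℂ) (ha : a ≠ 0) (hc : c ≠ 0)
    (hhom : ∀ i, (Ω i).IsHomogeneous 4)
    (heul : X 0 * Ω 0 + X 1 * Ω 1 + X 2 * Ω 2 = 0)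
    (h00 : coeff (mk3 0 4 0) (Ω 0) = 0) (h01 : coeff (mk3 1 3 0) (Ω 0) = 0)
    (h02 : coeff (mk3 2 2 0) (Ω 0) = 0) (h03 : coeff (mk3 3 1 0) (Ω 0) = c)
    (h0z : coeff (mk3 0 3 1) (Ω 0) = a)
    (h20 : coeff (mk3 0 4 0) (Ω 2) = 0) (h21 : coeff (mk3 1 3 0) (Ω 2) = -a)
    (i : Fin 3) (m : Fin 3 →₀ ℕ) :
    Tendsto (fun s : ℂ => coeff m (C (-c * s ^ 4)⁻¹ *
      pb3 (Matrix.diagonal ![s, 1, -c / a * s ^ 3]) Ω i)) (𝓝[≠] 0)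
      (𝓝 (coeff m (OmF1 i))) := by
  simp only [pb3_diag, coeff_C_mul, coeff_diag]
  by_cases hd : m 0 + m 1 + m 2 = 4
  swap
  · have z1 : coeff m (Ω i) = 0 := by
      by_contra h; exact hd (hom_deg (hhom i) h)
    have z2 : coeff m (OmF1 i) = 0 := by
      by_contra h; exact hd (hom_deg (F1_hom i) h)
    rw [z1, z2]
    simp
  obtain ⟨p, r, q, rfl⟩ : ∃ p r q, m = mk3 p r q := ⟨_, _, _, eq_mk3 m⟩
  simp only [mk3_0, mk3_1, mk3_2] at hd ⊢
  have ec := euler_coeff Ω heul p r q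
  fin_cases i
  · refine tend_weight (-c⁻¹ * (-c / a) ^ q * coeff (mk3 p r q) (Ω 0)) _ (p + 3 * q + 1) ?_ ?_ ?_ _ ?_
    · intro hw
      obtain rfl : q = 0 := by omega
      obtain rfl : r = 4 - p := by omega
      have : p < 3 := by omega
      interval_cases p <;> simp [h00, h01, h02]
    · intro hw
      have : (p = 3 ∧ r = 1 ∧ q = 0) ∨ (p = 0 ∧ r = 3 ∧ q = 1) := by omega
      change _ = coeff _ (OmF1 0)
      rw [F1_0]
      rcases this with ⟨rfl, rfl, rfl⟩ | ⟨rfl, rfl, rfl⟩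
      · simp [h03, coeff_monomial, mk3_inj, hc]
      · simp [h0z, coeff_monomial, mk3_inj]; field_simp
    · intro hw
      change coeff _ (OmF1 0) = 0
      rw [F1_0, coeff_sub, coeff_monomial, coeff_monomial, if_neg (by rw [mk3_inj]; omega),
        if_neg (by rw [mk3_inj]; omega), sub_zero]
    · intro s
      simp only [Fin.zero_eta, Matrix.cons_val_zero, Matrix.cons_val_one, Matrix.cons_val, one_pow,
        mul_inv, mul_pow, ← pow_mul, pow_add, inv_neg]
      ring
  · refine tend_weight (-c⁻¹ * (-c / a) ^ q * coeff (mk3 p r q) (Ω 1)) _ (p + 3 * q) ?_ ?_ ?_ _ ?_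
    · intro hw
      have : (q = 0 ∧ r = 4 - p ∧ p < 4) ∨ (q = 1 ∧ p = 0 ∧ r = 3) := by omega
      rw [ec]
      rcases this with ⟨rfl, rfl, h⟩ | ⟨rfl, rfl, rfl⟩
      · interval_cases p <;> simp [h00, h01, h02]
      · simp [h20]
    · intro hw
      have : (p = 4 ∧ r = 0 ∧ q = 0) ∨ (p = 1 ∧ r = 2 ∧ q = 1) := by omega
      change _ = coeff _ (OmF1 1)
      rw [F1_1, ec]
      rcases this with ⟨rfl, rfl, rfl⟩ | ⟨rfl, rfl, rfl⟩
      · simp [h03, coeff_monomial, hc]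
      · simp [h0z, h21, coeff_monomial, mk3_inj]
    · intro hw
      change coeff _ (OmF1 1) = 0
      rw [F1_1, coeff_monomial, if_neg (by rw [mk3_inj]; omega)]
    · intro s
      simp only [Fin.mk_one, Matrix.cons_val_zero, Matrix.cons_val_one, Matrix.cons_val, one_pow,
        mul_inv, mul_pow, ← pow_mul, pow_add, inv_neg]
      ring
  · refine tend_weight (-c⁻¹ * (-c / a) ^ (q + 1) * coeff (mk3 p r q) (Ω 2)) _ (p + 3 * q + 3) ?_ ?_ ?_ _ ?_
    · intro hw
      obtain ⟨rfl, rfl, rfl⟩ : p = 0 ∧ r = 4 ∧ q = 0 := by omega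
      simp [h20]
    · intro hw
      obtain ⟨rfl, rfl, rfl⟩ : p = 1 ∧ r = 3 ∧ q = 0 := by omega
      change _ = coeff _ (OmF1 2)
      rw [F1_2]
      simp [h21, coeff_monomial]; field_simp
    · intro hw
      change coeff _ (OmF1 2) = 0
      rw [F1_2, coeff_neg, coeff_monomial, if_neg (by rw [mk3_inj]; omega), neg_zero]
    · intro s
      simp only [Fin.reduceFinMk, Matrix.cons_val_zero, Matrix.cons_val_one, Matrix.cons_val,
        one_pow, mul_inv, mul_pow, ← pow_mul, pow_add, inv_neg]
      ring

lemma eval_pderiv_pb3 (M : Matrix (Fin 3) (Fin 3) ℂ) (Ω : Fin 3 → MvPolynomial (Fin 3) ℂ)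
    (p : Fin 3 → ℂ) (a b : Fin 3) :
    eval p (pderiv b (pb3 M Ω a)) =
      ∑ j, M j a * ∑ l, M l b * eval (M.mulVec p) (pderiv l (Ω j)) := by
  simp only [pb3, map_sum, pderiv_C_mul, map_mul, eval_C, eval_pderiv_subst3]

lemma closure_of (Ω : Fin 3 → MvPolynomial (Fin 3) ℂ) (hfol : IsFolDeg 3 Ω)
    (M : Matrix (Fin 3) (Fin 3) ℂ) (hM : IsUnit M.det) (a c : ℂ) (ha : a ≠ 0) (hc : c ≠ 0)
    (h00 : coeff (mk3 0 4 0) (pb3 M Ω 0) = 0) (h01 : coeff (mk3 1 3 0) (pb3 M Ω 0) = 0)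
    (h02 : coeff (mk3 2 2 0) (pb3 M Ω 0) = 0) (h03 : coeff (mk3 3 1 0) (pb3 M Ω 0) = c)
    (h0z : coeff (mk3 0 3 1) (pb3 M Ω 0) = a)
    (h20 : coeff (mk3 0 4 0) (pb3 M Ω 2) = 0) (h21 : coeff (mk3 1 3 0) (pb3 M Ω 2) = -a) :
    OrbitOf OmF1 ⊆ FClos 3 (OrbitOf Ω) := by
  intro Ω' hΩ'
  refine ⟨isFol_conj F1_fol hΩ', ?_⟩
  obtain ⟨R, k, hR, hk, hpb⟩ := hΩ'
  obtain ⟨-, hhom, heul, -⟩ := hfol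
  have hhom' := pb3_hom M hhom
  have hlim := main_lim (pb3 M Ω) a c ha hc hhom' (euler_pb3 M Ω heul) h00 h01 h02 h03 h0z h20 h21
  set T : ℂ → Matrix (Fin 3) (Fin 3) ℂ := fun s => Matrix.diagonal ![s, 1, -c / a * s ^ 3] with hT
  have hlim2 := tend_pb3 (l := 𝓝[≠] (0:ℂ)) R (d := 4)
    (fun s i => C (-c * s ^ 4)⁻¹ * pb3 (T s) (pb3 M Ω) i) OmF1
    (fun s i => by
      have := (isHomogeneous_C _ ((-c * s ^ 4)⁻¹)).mul (pb3_hom (T s) hhom' i)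
      rwa [zero_add] at this)
    F1_hom hlim
  have hΩeq : Ω' = fun i => C k⁻¹ * pb3 R OmF1 i := by
    funext i
    rw [hpb, ← mul_assoc, ← C_mul, inv_mul_cancel₀ hk, C_1, one_mul]
  let G : ℂ → Fin 3 → MvPolynomial (Fin 3) ℂ := fun s i =>
    C k⁻¹ * pb3 R (fun i => C (-c * s ^ 4)⁻¹ * pb3 (T s) (pb3 M Ω) i) i
  have hG : Tendsto (fun s => coeffs (G s)) (𝓝[≠] 0) (𝓝 (coeffs Ω')) := by
    rw [tendsto_pi_nhds]; intro i
    rw [tendsto_pi_nhds]; intro m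
    simp only [_root_.coeffs, G, hΩeq, coeff_C_mul]
    exact (hlim2 i m).const_mul _
  refine mem_closure_of_tendsto hG ?_
  filter_upwards [self_mem_nhdsWithin] with s hs
  have hs : s ≠ 0 := hs
  refine ⟨G s, ?_, rfl⟩
  have hcs : -c * s ^ 4 ≠ 0 := mul_ne_zero (neg_ne_zero.mpr hc) (pow_ne_zero _ hs)
  refine ⟨M * T s * R, k * (-c * s ^ 4), ?_, mul_ne_zero hk hcs, ?_⟩
  · rw [Matrix.det_mul, Matrix.det_mul]
    refine (hM.mul ?_).mul hR
    rw [hT]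
    simp only [Matrix.det_diagonal, Fin.prod_univ_three, isUnit_iff_ne_zero]
    simp [hs, hc, ha]
  · funext i
    simp only [G]
    rw [pb3_smul, pb3_comp, pb3_comp, ← mul_assoc, ← mul_assoc, ← C_mul, ← C_mul, mul_assoc M]
    have : k * (-c * s ^ 4) * k⁻¹ * (-c * s ^ 4)⁻¹ = 1 := by
      rw [mul_right_comm k, mul_inv_cancel₀ hk, one_mul, mul_inv_cancel₀ hcs]
    rw [this, C_1, one_mul]

lemma main_aux (Ω : Fin 3 → MvPolynomial (Fin 3) ℂ) (hfol : IsFolDeg 3 Ω)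
    (i j k : Fin 3) (m w v : Fin 3 → ℂ) (hij : i ≠ j) (hik : i ≠ k) (hjk : j ≠ k) (hmk : m k = 1)
    (hsing : ∀ l, eval m (Ω l) = 0)
    (hdet : eval m (pderiv i (Ω i)) * eval m (pderiv j (Ω j)) -
          eval m (pderiv j (Ω i)) * eval m (pderiv i (Ω j)) ≠ 0)
    (hBB : (eval m (pderiv j (Ω i)) - eval m (pderiv i (Ω j))) ^ 2 =
        4 * (eval m (pderiv i (Ω i)) * eval m (pderiv j (Ω j)) -
          eval m (pderiv j (Ω i)) * eval m (pderiv i (Ω j))))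
    (hwk : w k = 0) (hvk : v k = 0) (hwv : w i * v j - w j * v i ≠ 0)
    (ht3 : Polynomial.X ^ 3 ∣ tangPoly Ω k m w)
    (ht4 : ¬ Polynomial.X ^ 4 ∣ tangPoly Ω k m w) :
    OrbitOf OmF1 ⊆ FClos 3 (OrbitOf Ω) := by
  have hhom := hfol.2.1
  let M : Matrix (Fin 3) (Fin 3) ℂ := Matrix.of fun l => ![w l, m l, v l]
  have M0 : ∀ l, M l 0 = w l := fun l => rfl
  have M1 : ∀ l, M l 1 = m l := fun l => rfl
  have M2 : ∀ l, M l 2 = v l := fun l => rfl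
  have sum3 : ∀ f : Fin 3 → ℂ, ∑ l, f l = f i + f j + f k := by
    intro f
    rw [Fin.sum_univ_three]
    fin_cases i <;> fin_cases j <;> fin_cases k <;> simp at hij hik hjk ⊢ <;> ring
  have hM : IsUnit M.det := by
    rw [isUnit_iff_ne_zero, Matrix.det_fin_three]
    simp only [M0, M1, M2]
    intro h
    apply hwv
    fin_cases i <;> fin_cases j <;> fin_cases k <;> simp at hij hik hjk hmk hwk hvk h ⊢ <;>
      simp only [hmk, hwk, hvk] at h <;> first | linear_combination h | linear_combination -h
  have hhom' := pb3_hom M hhom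
  have hMe : M.mulVec ![0, 1, 0] = m := by
    funext l
    simp [Matrix.mulVec, dotProduct, Fin.sum_univ_three, M1]
  have hs' : ∀ l, coeff (mk3 0 4 0) (pb3 M Ω l) = 0 := by
    intro l
    rw [← eval_e1 (hhom' l)]
    simp [pb3, eval_subst3, hMe, hsing]
  have htr := tang_restr Ω k m w M M0 M1 hmk hwk
  rw [← htr] at ht3 ht4
  rw [Polynomial.X_pow_dvd_iff] at ht3 ht4
  have c1 := ht3 1 (by norm_num)
  have c2 := ht3 2 (by norm_num)
  have c3 : (aeval (![Polynomial.X, 1, 0] : Fin 3 → Polynomial ℂ) (pb3 M Ω 0)).coeff 3 ≠ 0 := by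
    intro h
    apply ht4
    intro n hn
    rcases Nat.lt_succ_iff_lt_or_eq.mp hn with h' | rfl
    · exact ht3 n h'
    · exact h
  rw [restr_coeff (hhom' 0) _ (by norm_num)] at c1 c2 c3
  norm_num at c1 c2 c3
  have d00 := (eval_e1_pderiv (hhom' 0)).2
  have d02 := (eval_e1_pderiv (hhom' 0)).1
  have d20 := (eval_e1_pderiv (hhom' 2)).2
  rw [c1] at d00
  rw [eval_pderiv_pb3, hMe] at d00 d02 d20
  simp only [sum3, M0, M2, hwk, hvk, zero_mul, add_zero] at d00 d02 d20
  generalize eval m (pderiv i (Ω i)) = A at *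
  generalize eval m (pderiv j (Ω i)) = B at *
  generalize eval m (pderiv i (Ω j)) = D at *
  generalize eval m (pderiv j (Ω j)) = E at *
  have hsum : coeff (mk3 1 3 0) (pb3 M Ω 2) = - coeff (mk3 0 3 1) (pb3 M Ω 0) := by
    have : (coeff (mk3 1 3 0) (pb3 M Ω 2) + coeff (mk3 0 3 1) (pb3 M Ω 0)) ^ 2 = 0 := by
      rw [← d20, ← d02]
      linear_combination (w i * v j - w j * v i) ^ 2 * hBB + 4 * d00 * (v i * (v i * A + v j * B) + v j * (v i * D + v j * E))
    linear_combination pow_eq_zero_iff (two_ne_zero) |>.mp this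
  have hane : coeff (mk3 0 3 1) (pb3 M Ω 0) ≠ 0 := by
    intro h0
    rw [h0] at hsum d02
    rw [hsum] at d20
    have : (w i * v j - w j * v i) ^ 2 * (A * E - B * D) = 0 := by
      linear_combination d00 * (v i * (v i * A + v j * B) + v j * (v i * D + v j * E)) - (v i * (w i * A + w j * B) + v j * (w i * D + w j * E)) * d02
    rcases mul_eq_zero.mp this with h | h
    · exact hwv (pow_eq_zero_iff two_ne_zero |>.mp h)
    · exact hdet h
  exact closure_of Ω hfol M hM _ _ hane c3 (hs' 0) c1 c2 rfl rfl (hs' 2) hsum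

/-- **Sufficient condition for degenerating onto `F₁`.**
Let `F` be a degree-3 foliation of `ℙ²(ℂ)`, not linearly conjugate to `F₁`.
Suppose `F` has a nondegenerate singular point `m` with `BB(F, m) = 4` and
`κ(F, m) = 3`, i.e. there is a line `ℓ` through `m`, not invariant by `F`, with
`Tang(F, ℓ, m) = 3`.  Then `F` degenerates onto `F₁`: `O(F₁)` is contained in the
closure of `O(F)` in `F(3)`. -/
theorem stmt_14 (Ω : Fin 3 → MvPolynomial (Fin 3) ℂ)
    (hfol : IsFolDeg 3 Ω)
    (hnc : ¬ LinConj3 Ω OmF1)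
    (hm : ∃ (i j k : Fin 3) (m : Fin 3 → ℂ), i ≠ j ∧ i ≠ k ∧ j ≠ k ∧ m k = 1 ∧
      (∀ l, eval m (Ω l) = 0) ∧
      (eval m (pderiv i (Ω i)) * eval m (pderiv j (Ω j)) -
          eval m (pderiv j (Ω i)) * eval m (pderiv i (Ω j)) ≠ 0) ∧
      (eval m (pderiv j (Ω i)) - eval m (pderiv i (Ω j))) ^ 2 =
        4 * (eval m (pderiv i (Ω i)) * eval m (pderiv j (Ω j)) -
          eval m (pderiv j (Ω i)) * eval m (pderiv i (Ω j))) ∧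
      ∃ L : MvPolynomial (Fin 3) ℂ, L.IsHomogeneous 1 ∧ L ≠ 0 ∧ eval m L = 0 ∧
        ¬ LineInv Ω L ∧
        ∃ w : Fin 3 → ℂ, w ≠ 0 ∧ w k = 0 ∧ eval w L = 0 ∧
          Polynomial.X ^ 3 ∣ tangPoly Ω k m w ∧
          ¬ Polynomial.X ^ 4 ∣ tangPoly Ω k m w) :
    OrbitOf OmF1 ⊆ FClos 3 (OrbitOf Ω) := by
  obtain ⟨i, j, k, m, hij, hik, hjk, hmk, hsing, hdet, hBB, L, -, -, -, -, w, hw, hwk, -, ht3, ht4⟩ := hm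
  by_cases hi : w i = 0
  · refine main_aux Ω hfol i j k m w (Pi.single i 1) hij hik hjk hmk hsing hdet hBB hwk ?_ ?_ ht3 ht4
    · simp [hik.symm]
    · simp only [Pi.single_eq_same, Pi.single_eq_of_ne hij.symm]
      intro h
      apply hw
      have hj : w j = 0 := by linear_combination -h
      funext l
      have : l = i ∨ l = j ∨ l = k := by
        clear * - hij hik hjk
        revert i j k l; decide
      rcases this with rfl | rfl | rfl <;> assumption
  · refine main_aux Ω hfol i j k m w (Pi.single j 1) hij hik hjk hmk hsing hdet hBB hwk ?_ ?_ ht3 ht4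
    · simp [hjk.symm]
    · simpa [Pi.single_eq_of_ne hij] using hi
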